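/- With the assumptions above (A non-negative in X, D = closure(D(A)), -A_D generating a bounded C₀-semigroup on D, 0 < Re α < 1), the closure of the Dirichlet-to-Neumann operator T_α equals c_α times the Balakrishnan operator: c_α · closure(J^α_A) = closure(T_α), where c_α = Γ(1-α)/(2^{2α-1}Γ(α)). -/

import Mathlib

open MeasureTheory Set Filter Topology

/-- The weight `r ^ z * exp (-s² / (4 r))` occurring in the subordination formula for the harmonic
extension. -/
noncomputable def expWeight (z : ℂ) (s r : ℝ) : ℂ :=
  (r : ℂ) ^ z * (Real.exp (-(s ^ 2) / (4 * r)) : ℂ)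

theorem norm_expWeight (z : ℂ) (s : ℝ) {r : ℝ} (hr : 0 < r) :
    ‖expWeight z s r‖ = r ^ z.re * Real.exp (-(s ^ 2) / (4 * r)) := by
  rw [expWeight, norm_mul, Complex.norm_cpow_eq_rpow_re_of_pos hr, Complex.norm_real,
    Real.norm_of_nonneg (Real.exp_pos _).le]

theorem integrableOn_rpow_mul_exp_neg_div {a c : ℝ} (ha : a < -1) (hc : 0 < c) :
    IntegrableOn (fun r : ℝ => r ^ a * Real.exp (-c / r)) (Ioi 0) := by
  have h : IntegrableOn (fun x : ℝ => x ^ (-a - 2) * Real.exp (-c * x ^ (1 : ℝ))) (Ioi 0) :=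
    integrableOn_rpow_mul_exp_neg_mul_rpow (by linarith) one_pos hc
  refine ((integrableOn_Ioi_comp_rpow_iff' _ (p := -1) (by norm_num)).mpr h).congr_fun ?_
    measurableSet_Ioi
  intro r (hr : 0 < r)
  simp only [smul_eq_mul, Real.rpow_one]
  rw [← mul_assoc, ← Real.rpow_mul hr.le, ← Real.rpow_add hr, Real.rpow_neg_one, div_eq_mul_inv]
  congr 2
  ring

theorem measurable_expWeight (z : ℂ) (s : ℝ) : Measurable (expWeight z s) := by
  unfold expWeight
  fun_prop

section

variable {X : Type*} [NormedAddCommGroup X] [NormedSpace ℂ X]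

theorem integrableOn_expWeight_smul {z : ℂ} (hz : z.re < -1) {s : ℝ} (hs : s ≠ 0) {g : ℝ → X}
    {K : ℝ} (hg : AEStronglyMeasurable g (volume.restrict (Ioi 0)))
    (hK : ∀ r, 0 < r → ‖g r‖ ≤ K) :
    IntegrableOn (fun r => expWeight z s r • g r) (Ioi 0) := by
  have hs2 : 0 < s ^ 2 / 4 := by positivity
  refine Integrable.mono' ((integrableOn_rpow_mul_exp_neg_div hz hs2).mul_const K)
    ((measurable_expWeight z s).aestronglyMeasurable.smul hg) ?_
  filter_upwards [ae_restrict_mem measurableSet_Ioi] with r (hr : 0 < r)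
  rw [norm_smul, norm_expWeight z s hr]
  have : -(s ^ 2) / (4 * r) = -(s ^ 2 / 4) / r := by field_simp
  rw [this]
  gcongr
  exact hK r hr

theorem hasDerivAt_expWeight (z : ℂ) (s : ℝ) {r : ℝ} (hr : 0 < r) :
    HasDerivAt (fun s => expWeight z s r) (-((s : ℂ) / 2) * expWeight (z - 1) s r) s := by
  have h1 : HasDerivAt (fun s : ℝ => -(s ^ 2) / (4 * r)) (-(2 * s) / (4 * r)) s := by
    simpa using ((hasDerivAt_pow 2 s).neg.div_const (4 * r))
  have h2 := (h1.exp.ofReal_comp).const_mul ((r : ℂ) ^ z)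
  refine h2.congr_deriv ?_
  have hr' : (r : ℂ) ≠ 0 := by exact_mod_cast hr.ne'
  rw [expWeight, Complex.cpow_sub _ _ hr', Complex.cpow_one]
  push_cast
  field_simp
  ring

theorem hasDerivAt_integral_expWeight_smul {z : ℂ} (hz : z.re < -1) {s : ℝ} (hs : 0 < s)
    {g : ℝ → X} {K : ℝ} (hg : AEStronglyMeasurable g (volume.restrict (Ioi 0)))
    (hK : ∀ r, 0 < r → ‖g r‖ ≤ K) :
    HasDerivAt (fun s : ℝ => ∫ r in Ioi (0 : ℝ), expWeight z s r • g r)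
      (-((s : ℂ) / 2) • ∫ r in Ioi (0 : ℝ), expWeight (z - 1) s r • g r) s := by
  have hK0 : 0 ≤ K := (norm_nonneg _).trans (hK 1 one_pos)
  have hz1 : (z - 1).re < -1 := by simp; linarith
  have hball : Ioo (s / 2) (2 * s) ∈ 𝓝 s := Ioo_mem_nhds (by linarith) (by linarith)
  have key := hasDerivAt_integral_of_dominated_loc_of_deriv_le
    (μ := volume.restrict (Ioi (0 : ℝ))) (F := fun s r => expWeight z s r • g r)
    (F' := fun s r => (-((s : ℂ) / 2) * expWeight (z - 1) s r) • g r) (x₀ := s)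
    (bound := fun r => s * (r ^ (z - 1).re * Real.exp (-((s / 2) ^ 2 / 4) / r) * K)) hball
    (Eventually.of_forall fun t => (measurable_expWeight z t).aestronglyMeasurable.smul hg)
    (integrableOn_expWeight_smul hz hs.ne' hg hK)
    (((measurable_expWeight (z - 1) s).const_mul _).aestronglyMeasurable.smul hg)
    ?_ (((integrableOn_rpow_mul_exp_neg_div hz1 (by positivity)).mul_const K).const_mul s) ?_
  · refine key.2.congr_deriv ?_
    rw [← integral_smul]
    simp only [mul_smul]
  · filter_upwards [ae_restrict_mem measurableSet_Ioi] with r (hr : 0 < r) t ht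
    have ht0 : 0 < t := lt_trans (by linarith) ht.1
    rw [norm_smul, norm_mul, norm_expWeight _ _ hr, norm_neg, norm_div, Complex.norm_real,
      Real.norm_of_nonneg ht0.le, Complex.norm_ofNat, mul_assoc]
    have h1 : t / 2 ≤ s := by linarith [ht.2]
    have h2 : -(t ^ 2) / (4 * r) ≤ -((s / 2) ^ 2 / 4) / r := by
      rw [div_le_div_iff₀ (by positivity) hr]
      nlinarith [pow_le_pow_left₀ (by linarith) ht.1.le 2]
    gcongr
    exact hK r hr
  · filter_upwards [ae_restrict_mem measurableSet_Ioi] with r (hr : 0 < r) t _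
    exact (hasDerivAt_expWeight z t hr).smul_const (g r)

end

theorem hasDerivAt_expWeight_right (z : ℂ) (s : ℝ) {r : ℝ} (hr : 0 < r) :
    HasDerivAt (fun r => expWeight z s r)
      (z * expWeight (z - 1) s r + (s : ℂ) ^ 2 / 4 * expWeight (z - 2) s r) r := by
  have hr' : (r : ℂ) ≠ 0 := by exact_mod_cast hr.ne'
  have h1 : HasDerivAt (fun r : ℝ => -(s ^ 2) / (4 * r)) (s ^ 2 / (4 * r ^ 2)) r := by
    have := ((hasDerivAt_id r).const_mul 4).inv (by simpa using hr.ne') |>.const_mul (-(s ^ 2))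
    refine (this.congr_deriv ?_)
    simp
    field_simp
  have h2 := h1.exp.ofReal_comp
  have h3 : HasDerivAt (fun r : ℝ => (r : ℂ) ^ z) (z * (r : ℂ) ^ (z - 1)) r := by
    simpa using ((hasDerivAt_id (r : ℂ)).cpow_const (c := z)
      (Complex.ofReal_mem_slitPlane.mpr hr)).comp_ofReal
  refine (h3.mul h2).congr_deriv ?_
  rw [expWeight, expWeight, Complex.cpow_sub _ _ hr', Complex.cpow_sub _ _ hr', Complex.cpow_one,
    Complex.cpow_ofNat]
  push_cast
  field_simp

theorem integral_deriv_expWeight {z : ℂ} (hz : z.re < 0) {s : ℝ} (hs : s ≠ 0) :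
    ∫ r in Ioi (0 : ℝ),
      (z * expWeight (z - 1) s r + (s : ℂ) ^ 2 / 4 * expWeight (z - 2) s r) = 0 := by
  have hz0 : z ≠ 0 := by rintro rfl; simp at hz
  have hs2 : 0 < s ^ 2 / 4 := by positivity
  have hval : expWeight z s 0 = 0 := by simp [expWeight, Complex.zero_cpow hz0]
  have hint : ∀ w : ℂ, w.re < -1 → IntegrableOn (expWeight w s) (Ioi 0) := fun w hw => by
    simpa using integrableOn_expWeight_smul (X := ℂ) hw hs (g := fun _ => 1) (K := 1)
      aestronglyMeasurable_const (by simp)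
  rw [integral_Ioi_of_hasDerivAt_of_tendsto (f := expWeight z s) (m := 0) ?_
    (fun r hr => hasDerivAt_expWeight_right z s hr) ?_ ?_, hval, sub_zero]
  · rw [← continuousWithinAt_Ioi_iff_Ici, ContinuousWithinAt, hval]
    refine squeeze_zero_norm' (Eventually.of_forall fun _ => le_rfl) ?_
    refine ((tendsto_rpow_mul_exp_neg_mul_atTop_nhds_zero (-z.re) _ hs2).comp
      tendsto_inv_nhdsGT_zero).congr' ?_
    filter_upwards [self_mem_nhdsWithin] with r (hr : 0 < r)
    rw [norm_expWeight _ _ hr, Function.comp_apply, Real.inv_rpow hr.le, Real.rpow_neg hr.le,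
      inv_inv]
    congr 2
    field_simp
  · exact ((hint _ (by simp; linarith)).const_mul _).add ((hint _ (by simp; linarith)).const_mul _)
  · refine squeeze_zero_norm' (a := fun r : ℝ => r ^ (- -z.re)) ?_
      (tendsto_rpow_neg_atTop (by linarith))
    filter_upwards [eventually_gt_atTop 0] with r hr
    rw [norm_expWeight _ _ hr, neg_neg]
    refine mul_le_of_le_one_right (by positivity) (Real.exp_le_one_iff.mpr ?_)
    rw [neg_div, neg_nonpos]
    positivity

theorem integrableOn_rpow_mul_norm_of_le {X : Type*} [NormedAddCommGroup X] {a C K : ℝ}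
    (h0 : 0 < a) (h1 : a < 1) {h : ℝ → X}
    (hh : AEStronglyMeasurable h (volume.restrict (Ioi 0)))
    (hC : ∀ r, 0 < r → ‖h r‖ ≤ C * r) (hK : ∀ r, 0 < r → ‖h r‖ ≤ K) :
    IntegrableOn (fun r : ℝ => r ^ (-a - 1) * ‖h r‖) (Ioi 0) := by
  have hmeas : AEStronglyMeasurable (fun r : ℝ => r ^ (-a - 1) * ‖h r‖)
      (volume.restrict (Ioi 0)) :=
    AEStronglyMeasurable.mul (by fun_prop) hh.norm
  rw [← Ioc_union_Ioi_eq_Ioi zero_le_one, integrableOn_union]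
  constructor
  · have hi : IntegrableOn (fun r : ℝ => r ^ (-a) * C) (Ioc 0 1) :=
      ((intervalIntegrable_iff_integrableOn_Ioc_of_le zero_le_one).mp
        (intervalIntegral.intervalIntegrable_rpow' (by linarith))).mul_const C
    refine Integrable.mono' hi
      (hmeas.mono_measure (Measure.restrict_mono Ioc_subset_Ioi_self le_rfl)) ?_
    filter_upwards [ae_restrict_mem measurableSet_Ioc] with r hr
    rw [Real.norm_of_nonneg (mul_nonneg (Real.rpow_nonneg hr.1.le _) (norm_nonneg _)),
      show -a = -a - 1 + 1 by ring, Real.rpow_add_one hr.1.ne',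
      show -a - 1 + 1 - 1 = -a - 1 by ring,
      mul_assoc, mul_comm r C]
    exact mul_le_mul_of_nonneg_left (hC r hr.1) (Real.rpow_nonneg hr.1.le _)
  · have hi : IntegrableOn (fun r : ℝ => r ^ (-a - 1) * K) (Ioi 1) :=
      (integrableOn_Ioi_rpow_of_lt (by linarith) one_pos).mul_const K
    refine Integrable.mono' hi
      (hmeas.mono_measure (Measure.restrict_mono (Ioi_subset_Ioi zero_le_one) le_rfl)) ?_
    filter_upwards [ae_restrict_mem measurableSet_Ioi] with r (hr : 1 < r)
    have hr0 : 0 < r := one_pos.trans hr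
    rw [Real.norm_of_nonneg (mul_nonneg (Real.rpow_nonneg hr0.le _) (norm_nonneg _))]
    exact mul_le_mul_of_nonneg_left (hK r hr0) (Real.rpow_nonneg hr0.le _)

section

variable {X : Type*} [NormedAddCommGroup X] [NormedSpace ℂ X]

theorem hasDerivAt_extension {α : ℂ} (h0 : 0 < α.re) {s : ℝ} (hs : 0 < s) {g : ℝ → X} {K : ℝ}
    (hg : AEStronglyMeasurable g (volume.restrict (Ioi 0))) (hK : ∀ r, 0 < r → ‖g r‖ ≤ K) :
    HasDerivAt (fun s : ℝ => (1 / Complex.Gamma α) •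
        (((s : ℂ) / 2) ^ (2 * α) • ∫ r in Ioi (0 : ℝ), expWeight (-α - 1) s r • g r))
      (-((s : ℂ) ^ (2 * α - 1)) • (2 ^ (1 - 2 * α) / Complex.Gamma α) •
        ∫ r in Ioi (0 : ℝ), (-α * expWeight (-α - 1) s r +
          (s : ℂ) ^ 2 / 4 * expWeight (-α - 2) s r) • g r) s := by
  have hs' : (s : ℂ) ≠ 0 := by exact_mod_cast hs.ne'
  have hs2 : (((s / 2 : ℝ)) : ℂ) = (s : ℂ) / 2 := by push_cast; rfl
  have hz1 : (-α - 1).re < -1 := by simp; linarith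
  have hz2 : (-α - 2).re < -1 := by simp; linarith
  have h1 : HasDerivAt (fun s : ℝ => ((s : ℂ) / 2) ^ (2 * α))
      (α * ((s : ℂ) / 2) ^ (2 * α - 1)) s := by
    have := (((hasDerivAt_id (s : ℂ)).div_const 2).cpow_const (c := 2 * α)
      (show id (s : ℂ) / 2 ∈ Complex.slitPlane from
        hs2 ▸ Complex.ofReal_mem_slitPlane.mpr (half_pos hs))).comp_ofReal
    refine this.congr_deriv ?_
    simp only [id]
    ring
  refine ((h1.smul (hasDerivAt_integral_expWeight_smul hz1 hs hg hK)).const_smul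
    (1 / Complex.Gamma α)).congr_deriv ?_
  have hadd : ∫ r in Ioi (0 : ℝ), (-α * expWeight (-α - 1) s r +
          (s : ℂ) ^ 2 / 4 * expWeight (-α - 2) s r) • g r =
      (-α) • (∫ r in Ioi (0 : ℝ), expWeight (-α - 1) s r • g r) +
        ((s : ℂ) ^ 2 / 4) • ∫ r in Ioi (0 : ℝ), expWeight (-α - 2) s r • g r := by
    simp only [add_smul, mul_smul]
    rw [integral_add, integral_smul, integral_smul]
    · exact (integrableOn_expWeight_smul hz1 hs.ne' hg hK).smul (-α)
    · exact (integrableOn_expWeight_smul hz2 hs.ne' hg hK).smul ((s : ℂ) ^ 2 / 4)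
  have hpow : ((s : ℂ) / 2) ^ (2 * α - 1) = (s : ℂ) ^ (2 * α - 1) * 2 ^ (1 - 2 * α) := by
    rw [← hs2, div_eq_mul_inv, Complex.ofReal_mul, Complex.mul_cpow_ofReal_nonneg hs.le (by simp),
      Complex.ofReal_inv, Complex.ofReal_ofNat,
      Complex.inv_cpow _ _ (by simp [Real.pi_ne_zero.symm]),
      ← Complex.cpow_neg, neg_sub]
  have hpow2 : ((s : ℂ) / 2) ^ (2 * α) = ((s : ℂ) / 2) ^ (2 * α - 1) * (s / 2) := by
    rw [Complex.cpow_sub _ _ (by simpa using hs'), Complex.cpow_one, div_mul_cancel₀]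
    simpa using hs'
  rw [hadd, hpow2, hpow, show -α - 1 - 1 = -α - 2 by ring]
  module

theorem norm_deriv_expWeight_le (α : ℂ) (s : ℝ) {r : ℝ} (hr : 0 < r) :
    ‖-α * expWeight (-α - 1) s r + (s : ℂ) ^ 2 / 4 * expWeight (-α - 2) s r‖ ≤
      (‖α‖ + 1) * r ^ (-α.re - 1) := by
  have hp : 0 ≤ r ^ (-α.re - 1) := Real.rpow_nonneg hr.le _
  have he : Real.exp (-(s ^ 2) / (4 * r)) ≤ 1 := by
    rw [Real.exp_le_one_iff, neg_div, neg_nonpos]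
    positivity
  have hue : s ^ 2 / (4 * r) * Real.exp (-(s ^ 2) / (4 * r)) ≤ 1 := by
    rw [neg_div, Real.exp_neg, ← div_eq_mul_inv, div_le_one (Real.exp_pos _)]
    linarith [Real.add_one_le_exp (s ^ 2 / (4 * r))]
  refine (norm_add_le _ _).trans ?_
  rw [norm_mul, norm_mul, norm_expWeight _ _ hr, norm_expWeight _ _ hr, norm_neg, norm_div,
    norm_pow, Complex.norm_real, Real.norm_eq_abs, sq_abs, Complex.norm_ofNat]
  simp only [Complex.sub_re, Complex.neg_re, Complex.one_re, Complex.re_ofNat]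
  rw [show -α.re - 2 = -α.re - 1 - 1 by ring, Real.rpow_sub_one hr.ne' (-α.re - 1), add_mul,
    one_mul]
  refine add_le_add ?_ ?_
  · exact mul_le_mul_of_nonneg_left (mul_le_of_le_one_right hp he) (norm_nonneg _)
  · calc _ = r ^ (-α.re - 1) * (s ^ 2 / (4 * r) * Real.exp (-(s ^ 2) / (4 * r))) := by
          field_simp
      _ ≤ _ := mul_le_of_le_one_right hp hue

theorem tendsto_deriv_expWeight (α : ℂ) (r : ℝ) :
    Tendsto (fun s => -α * expWeight (-α - 1) s r + (s : ℂ) ^ 2 / 4 * expWeight (-α - 2) s r)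
      (𝓝 0) (𝓝 (-α * (r : ℂ) ^ (-α - 1))) := by
  have hc : Continuous
      (fun s => -α * expWeight (-α - 1) s r + (s : ℂ) ^ 2 / 4 * expWeight (-α - 2) s r) := by
    unfold expWeight
    fun_prop
  simpa [expWeight] using hc.tendsto 0

theorem integrableOn_deriv_expWeight_smul {α : ℂ} (h0 : 0 < α.re) {s : ℝ} (hs : s ≠ 0) {g : ℝ → X}
    {K : ℝ} (hg : AEStronglyMeasurable g (volume.restrict (Ioi 0)))
    (hK : ∀ r, 0 < r → ‖g r‖ ≤ K) :
    IntegrableOn (fun r => (-α * expWeight (-α - 1) s r +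
      (s : ℂ) ^ 2 / 4 * expWeight (-α - 2) s r) • g r) (Ioi 0) := by
  have hz1 : (-α - 1).re < -1 := by simp; linarith
  have hz2 : (-α - 2).re < -1 := by simp; linarith
  simp only [add_smul, mul_smul]
  exact ((integrableOn_expWeight_smul hz1 hs hg hK).smul (-α)).add
    ((integrableOn_expWeight_smul hz2 hs hg hK).smul ((s : ℂ) ^ 2 / 4))

theorem tendsto_integral_deriv_expWeight_smul [CompleteSpace X] {α : ℂ} (h0 : 0 < α.re)
    (h1 : α.re < 1) {g : ℝ → X} {x : X} {C K : ℝ}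
    (hg : AEStronglyMeasurable g (volume.restrict (Ioi 0)))
    (hC : ∀ r, 0 < r → ‖g r - x‖ ≤ C * r) (hK : ∀ r, 0 < r → ‖g r‖ ≤ K) :
    Tendsto (fun s : ℝ => ∫ r in Ioi (0 : ℝ), (-α * expWeight (-α - 1) s r +
          (s : ℂ) ^ 2 / 4 * expWeight (-α - 2) s r) • g r) (𝓝[>] 0)
      (𝓝 (∫ r in Ioi (0 : ℝ), (-α * (r : ℂ) ^ (-α - 1)) • (g r - x))) := by
  have hmeas : AEStronglyMeasurable (fun r => g r - x) (volume.restrict (Ioi 0)) :=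
    hg.sub aestronglyMeasurable_const
  have hK' : ∀ r, 0 < r → ‖g r - x‖ ≤ K + ‖x‖ := fun r hr =>
    (norm_sub_le _ _).trans (by gcongr; exact hK r hr)
  have hlim := tendsto_integral_filter_of_dominated_convergence
    (μ := volume.restrict (Ioi (0 : ℝ))) (l := 𝓝[>] (0 : ℝ))
    (F := fun s r => (-α * expWeight (-α - 1) s r +
      (s : ℂ) ^ 2 / 4 * expWeight (-α - 2) s r) • (g r - x))
    (f := fun r => (-α * (r : ℂ) ^ (-α - 1)) • (g r - x))
    (fun r => (‖α‖ + 1) * (r ^ (-α.re - 1) * ‖g r - x‖)) ?_ ?_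
    ((integrableOn_rpow_mul_norm_of_le h0 h1 hmeas hC hK').const_mul _) ?_
  · refine hlim.congr' ?_
    filter_upwards [self_mem_nhdsWithin] with s (hs : 0 < s)
    simp only [smul_sub]
    rw [integral_sub (integrableOn_deriv_expWeight_smul h0 hs.ne' hg hK)
      (integrableOn_deriv_expWeight_smul h0 hs.ne' (g := fun _ => x) aestronglyMeasurable_const
        (fun _ _ => le_rfl)), integral_smul_const,
      integral_deriv_expWeight (by simpa using h0) hs.ne',
      zero_smul, sub_zero]
  · refine Eventually.of_forall fun s => AEStronglyMeasurable.smul ?_ hmeas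
    exact (((measurable_expWeight _ s).const_mul _).add
      ((measurable_expWeight _ s).const_mul _)).aestronglyMeasurable
  · refine Eventually.of_forall fun s => ?_
    filter_upwards [ae_restrict_mem measurableSet_Ioi] with r (hr : 0 < r)
    rw [norm_smul, ← mul_assoc]
    exact mul_le_mul_of_nonneg_right (norm_deriv_expWeight_le α s hr) (norm_nonneg _)
  · exact Eventually.of_forall fun r =>
      ((tendsto_deriv_expWeight α r).mono_left nhdsWithin_le_nhds).smul_const _

theorem integral_cpow_smul_laplace [CompleteSpace X] {α : ℂ} (h0 : 0 < α.re) (h1 : α.re < 1)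
    {h : ℝ → X} {C K : ℝ} (hh : AEStronglyMeasurable h (volume.restrict (Ioi 0)))
    (hC : ∀ r, 0 < r → ‖h r‖ ≤ C * r) (hK : ∀ r, 0 < r → ‖h r‖ ≤ K) :
    ∫ t in Ioi (0 : ℝ), (t : ℂ) ^ α • ∫ r in Ioi (0 : ℝ), (Real.exp (-(t * r)) : ℂ) • h r =
      Complex.Gamma (α + 1) • ∫ r in Ioi (0 : ℝ), (r : ℂ) ^ (-α - 1) • h r := by
  have hα1 : 0 < (α + 1).re := by simp; linarith
  have hker : ∀ r : ℝ, 0 < r → IntegrableOn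
      (fun t : ℝ => t ^ α.re * Real.exp (-(t * r))) (Ioi 0) := fun r hr => by
    simpa [mul_comm] using
      integrableOn_rpow_mul_exp_neg_mul_rpow (s := α.re) (by linarith) one_pos hr
  have hnorm : ∀ t r : ℝ, 0 < t → ‖((t : ℂ) ^ α * (Real.exp (-(t * r)) : ℂ)) • h r‖ =
      t ^ α.re * Real.exp (-(t * r)) * ‖h r‖ := fun t r ht => by
    rw [norm_smul, norm_mul, Complex.norm_cpow_eq_rpow_re_of_pos ht, Complex.norm_real,
      Real.norm_of_nonneg (Real.exp_pos _).le]
  have hprod : Integrable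
      (Function.uncurry fun t r : ℝ => ((t : ℂ) ^ α * (Real.exp (-(t * r)) : ℂ)) • h r)
      ((volume.restrict (Ioi 0)).prod (volume.restrict (Ioi 0))) := by
    have hmeas : AEStronglyMeasurable
        (Function.uncurry fun t r : ℝ => ((t : ℂ) ^ α * (Real.exp (-(t * r)) : ℂ)) • h r)
        ((volume.restrict (Ioi 0)).prod (volume.restrict (Ioi 0))) := by
      refine AEStronglyMeasurable.smul (f := fun p : ℝ × ℝ =>
        (p.1 : ℂ) ^ α * (Real.exp (-(p.1 * p.2)) : ℂ)) (g := fun p => h p.2) ?_ hh.comp_snd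
      fun_prop
    rw [integrable_prod_iff' hmeas]
    constructor
    · filter_upwards [ae_restrict_mem measurableSet_Ioi] with r (hr : 0 < r)
      refine Integrable.mono' ((hker r hr).mul_const ‖h r‖) ?_ ?_
      · exact AEStronglyMeasurable.smul (g := fun _ => h r) (by fun_prop)
          aestronglyMeasurable_const
      · filter_upwards [ae_restrict_mem measurableSet_Ioi] with t (ht : 0 < t)
        exact (hnorm t r ht).le
    · refine ((integrableOn_rpow_mul_norm_of_le h0 h1 hh hC hK).const_mul
        (Real.Gamma (α.re + 1))).congr ?_
      filter_upwards [ae_restrict_mem measurableSet_Ioi] with r (hr : 0 < r)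
      have hG := Real.integral_rpow_mul_exp_neg_mul_Ioi (a := α.re + 1) (by linarith) hr
      simp only [Function.uncurry_apply_pair]
      rw [setIntegral_congr_fun measurableSet_Ioi fun t ht => hnorm t r ht, integral_mul_const,
        ← mul_assoc]
      congr 1
      rw [add_sub_cancel_right] at hG
      simp only [mul_comm _ r, hG]
      rw [one_div, Real.inv_rpow hr.le, ← Real.rpow_neg hr.le, mul_comm, neg_add']
  calc _ = ∫ t in Ioi (0 : ℝ), ∫ r in Ioi (0 : ℝ),
        ((t : ℂ) ^ α * (Real.exp (-(t * r)) : ℂ)) • h r := by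
        simp only [mul_smul, integral_smul]
    _ = ∫ r in Ioi (0 : ℝ), ∫ t in Ioi (0 : ℝ),
        ((t : ℂ) ^ α * (Real.exp (-(t * r)) : ℂ)) • h r := integral_integral_swap hprod
    _ = ∫ r in Ioi (0 : ℝ), Complex.Gamma (α + 1) • (r : ℂ) ^ (-α - 1) • h r := by
        refine setIntegral_congr_fun measurableSet_Ioi fun r (hr : 0 < r) => ?_
        have hG := Complex.integral_cpow_mul_exp_neg_mul_Ioi hα1 hr
        simp only [integral_smul_const]
        rw [← mul_smul]
        congr 1
        rw [add_sub_cancel_right] at hG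
        have hinv : (1 / (r : ℂ)) ^ (α + 1) = (r : ℂ) ^ (-α - 1) := by
          rw [one_div, Complex.inv_cpow _ _ (by
            rw [Complex.arg_ofReal_of_nonneg hr.le]; exact Real.pi_ne_zero.symm),
            ← Complex.cpow_neg, neg_add']
        rw [hinv] at hG
        rw [mul_comm, ← hG]
        simp [mul_comm]
    _ = _ := integral_smul _ _

end

section

variable {X : Type*} [NormedAddCommGroup X]

theorem exists_norm_sub_le_mul_of_hasDerivAt [NormedSpace ℝ X] {f : ℝ → X} {f' : X} {K : ℝ}
    (hf : HasDerivAt f f' 0) (hK : ∀ r, 0 < r → ‖f r - f 0‖ ≤ K) :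
    ∃ C, ∀ r, 0 < r → ‖f r - f 0‖ ≤ C * r := by
  obtain ⟨c, hc⟩ := hf.isBigO_sub.bound
  obtain ⟨δ, hδ, hball⟩ := Metric.eventually_nhds_iff.mp hc
  refine ⟨max c (K / δ), fun r hr => ?_⟩
  rcases lt_or_ge r δ with h | h
  · have := hball (y := r) (by simpa [abs_of_pos hr] using h)
    rw [sub_zero, Real.norm_of_nonneg hr.le] at this
    exact this.trans (by gcongr; exact le_max_left _ _)
  · have hK0 : 0 ≤ K := (norm_nonneg _).trans (hK r hr)
    calc ‖f r - f 0‖ ≤ K / δ * δ := by rw [div_mul_cancel₀ _ hδ.ne']; exact hK r hr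
      _ ≤ K / δ * r := by gcongr
      _ ≤ max c (K / δ) * r := by gcongr; exact le_max_right _ _

theorem integrableOn_exp_neg_mul_smul [NormedSpace ℂ X] {l : ℝ} (hl : 0 < l) {g : ℝ → X} {K : ℝ}
    (hg : AEStronglyMeasurable g (volume.restrict (Ioi 0))) (hK : ∀ r, 0 < r → ‖g r‖ ≤ K) :
    IntegrableOn (fun r : ℝ => (Real.exp (-(l * r)) : ℂ) • g r) (Ioi 0) := by
  have hexp : IntegrableOn (fun r : ℝ => Real.exp (-(l * r)) * K) (Ioi 0) := by
    simpa [IntegrableOn] using (exp_neg_integrableOn_Ioi 0 hl).mul_const K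
  refine Integrable.mono' hexp (AEStronglyMeasurable.smul (by fun_prop) hg) ?_
  filter_upwards [ae_restrict_mem measurableSet_Ioi] with r (hr : 0 < r)
  rw [norm_smul, Complex.norm_real, Real.norm_of_nonneg (Real.exp_pos _).le]
  exact mul_le_mul_of_nonneg_left (hK r hr) (Real.exp_pos _).le

theorem integral_exp_neg_mul_Ioi {l : ℝ} (hl : 0 < l) :
    ∫ r in Ioi (0 : ℝ), (Real.exp (-(l * r)) : ℂ) = (l : ℂ)⁻¹ := by
  rw [integral_complex_ofReal]
  have := integral_exp_mul_Ioi (neg_lt_zero.mpr hl) 0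
  simp only [neg_mul] at this
  rw [this]
  simp

/-- If `u` is a bounded solution of `du/dt = -A u`, then the resolvent of `A` at `-l` applied to
`u 0` is the Laplace transform of `u`. -/
theorem resolvent_apply_eq_integral [NormedSpace ℂ X] [CompleteSpace X] {A : X →ₗ.[ℂ] X}
    {S : X →L[ℂ] X} {l K : ℝ} (hl : 0 < l)
    (hS : ∀ x : A.domain, S (A x + (l : ℂ) • (x : X)) = x) {u : ℝ → X}
    (hu : ∀ t : ℝ, 0 ≤ t → ∃ hm : u t ∈ A.domain, HasDerivAt u (-(A ⟨u t, hm⟩)) t)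
    (hK : ∀ t, 0 ≤ t → ‖u t‖ ≤ K) :
    S (u 0) = ∫ r in Ioi (0 : ℝ), (Real.exp (-(l * r)) : ℂ) • u r := by
  have hcont : ContinuousOn u (Ioi 0) := fun t ht =>
    (hu t (le_of_lt ht)).choose_spec.continuousAt.continuousWithinAt
  have hderiv : ∀ t ∈ Ici (0 : ℝ), HasDerivAt (fun r : ℝ => -(Real.exp (-(l * r)) : ℂ) • S (u r))
      ((Real.exp (-(l * t)) : ℂ) • u t) t := fun t ht => by
    obtain ⟨hm, hd⟩ := hu t ht
    have hA : S (A ⟨u t, hm⟩) = u t - (l : ℂ) • S (u t) := by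
      have := hS ⟨u t, hm⟩
      rw [map_add, map_smul] at this
      exact eq_sub_of_add_eq this
    have he : HasDerivAt (fun r : ℝ => -(Real.exp (-(l * r)) : ℂ))
        ((l : ℂ) * (Real.exp (-(l * t)) : ℂ)) t := by
      have := (((hasDerivAt_id t).const_mul l).neg.exp.ofReal_comp).neg
      refine this.congr_deriv ?_
      simp [mul_comm]
    have hSu : HasDerivAt (fun r => S (u r)) (S (-(A ⟨u t, hm⟩))) t :=
      (S.restrictScalars ℝ).hasFDerivAt.comp_hasDerivAt t hd
    refine (he.smul hSu).congr_deriv ?_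
    rw [map_neg, hA]
    module
  have hlim : Tendsto (fun r : ℝ => -(Real.exp (-(l * r)) : ℂ) • S (u r)) atTop (𝓝 0) := by
    have hexp : Tendsto (fun r : ℝ => Real.exp (-(l * r)) * (‖S‖ * K)) atTop (𝓝 0) := by
      simpa using (Real.tendsto_exp_neg_atTop_nhds_zero.comp
        (tendsto_id.const_mul_atTop hl)).mul_const (‖S‖ * K)
    refine squeeze_zero_norm' ?_ hexp
    filter_upwards [eventually_ge_atTop 0] with r hr
    rw [norm_smul, norm_neg, Complex.norm_real, Real.norm_of_nonneg (Real.exp_pos _).le]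
    gcongr
    exact (S.le_opNorm _).trans (by gcongr; exact hK r hr)
  rw [integral_Ioi_of_hasDerivAt_of_tendsto' hderiv (integrableOn_exp_neg_mul_smul hl
    (hcont.aestronglyMeasurable measurableSet_Ioi) fun r hr => hK r hr.le) hlim]
  simp

/-- A bounded family of resolvents satisfies `l R(l) y → y` on the closure of the domain. -/
theorem tendsto_smul_resolvent [NormedSpace ℂ X] {A : X →ₗ.[ℂ] X} {R : ℝ → X →L[ℂ] X} {M : ℝ}
    (hRinv : ∀ l : ℝ, 0 < l → ∀ x : A.domain, R l (A x + (l : ℂ) • (x : X)) = x)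
    (hM : ∀ l : ℝ, 0 < l → ‖(l : ℂ) • R l‖ ≤ M) {y : X}
    (hy : y ∈ closure (A.domain : Set X)) :
    Tendsto (fun l : ℝ => ((l : ℂ) • R l) y) atTop (𝓝 y) := by
  have hM0 : 0 ≤ M := (norm_nonneg _).trans (hM 1 one_pos)
  have hbd : ∀ l : ℝ, 0 < l → ∀ z : A.domain,
      ‖((l : ℂ) • R l) y - y‖ ≤ (M + 1) * ‖y - z‖ + M * ‖A z‖ * l⁻¹ := fun l hl z => by
    have hz : ((l : ℂ) • R l) (z : X) - z = -(R l (A z)) := by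
      have h := hRinv l hl z
      rw [map_add, map_smul] at h
      rw [eq_sub_of_add_eq h, smul_apply, neg_sub]
    have hRn : ‖R l (A z)‖ ≤ M * ‖A z‖ * l⁻¹ := by
      have h1 := ((l : ℂ) • R l).le_of_opNorm_le (hM l hl) (A z)
      rw [smul_apply, norm_smul, Complex.norm_real,
        Real.norm_of_nonneg hl.le] at h1
      rwa [← div_eq_mul_inv, le_div_iff₀' hl]
    have h2 := ((l : ℂ) • R l).le_of_opNorm_le (hM l hl) (y - z)
    calc ‖((l : ℂ) • R l) y - y‖
        = ‖((l : ℂ) • R l) (y - z) - (y - z) + (((l : ℂ) • R l) (z : X) - z)‖ := by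
          rw [map_sub]; congr 1; abel
      _ ≤ ‖((l : ℂ) • R l) (y - z)‖ + ‖y - z‖ + ‖((l : ℂ) • R l) (z : X) - z‖ :=
          (norm_add_le _ _).trans (by gcongr; exact norm_sub_le _ _)
      _ ≤ (M + 1) * ‖y - z‖ + M * ‖A z‖ * l⁻¹ := by
          rw [hz, norm_neg]
          linarith
  rw [Metric.tendsto_nhds]
  intro ε hε
  obtain ⟨z, hz, hyz⟩ := Metric.mem_closure_iff.mp hy (ε / (2 * (M + 1))) (by positivity)
  have hsmall : ∀ᶠ l : ℝ in atTop, M * ‖A ⟨z, hz⟩‖ * l⁻¹ < ε / 2 := by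
    have : Tendsto (fun l : ℝ => M * ‖A ⟨z, hz⟩‖ * l⁻¹) atTop (𝓝 0) := by
      simpa using tendsto_inv_atTop_zero.const_mul (M * ‖A ⟨z, hz⟩‖)
    exact this.eventually_lt_const (by positivity)
  filter_upwards [hsmall, eventually_gt_atTop 0] with l h1 hl
  have h2 := hbd l hl ⟨z, hz⟩
  have h3 : (M + 1) * ‖y - z‖ < ε / 2 := by
    rw [dist_eq_norm, lt_div_iff₀ (by positivity)] at hyz
    linarith
  rw [dist_eq_norm]
  exact h2.trans_lt (by simpa using (add_lt_add h3 h1).trans_eq (add_halves ε))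

end

theorem balakrishnan_constant {α : ℂ} (h0 : 0 < α.re) (h1 : α.re < 1) :
    Complex.Gamma (1 - α) / (2 ^ (2 * α - 1) * Complex.Gamma α) *
      (Complex.sin (α * Real.pi) / (Real.pi : ℂ) * Complex.Gamma (α + 1)) =
    2 ^ (1 - 2 * α) / Complex.Gamma α * α := by
  have hα : α ≠ 0 := by rintro rfl; simp at h0
  have hG := Complex.Gamma_ne_zero_of_re_pos h0
  have hG1 : Complex.Gamma (1 - α) ≠ 0 := Complex.Gamma_ne_zero_of_re_pos (by simpa using h1)
  have hr := Complex.Gamma_mul_Gamma_one_sub α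
  rw [mul_comm (Real.pi : ℂ) α] at hr
  have hpi : (Real.pi : ℂ) ≠ 0 := by exact_mod_cast Real.pi_ne_zero
  have hsin : Complex.sin (α * Real.pi) ≠ 0 := fun h => by
    rw [h, div_zero] at hr
    exact mul_ne_zero hG hG1 hr
  have h2 : (2 : ℂ) ^ (2 * α - 1) ≠ 0 := by simp [Complex.cpow_eq_zero_iff]
  rw [Complex.Gamma_add_one α hα, show (1 - 2 * α) = -(2 * α - 1) by ring, Complex.cpow_neg]
  rw [eq_div_iff hsin] at hr
  field_simp
  linear_combination hr

/-- `A` non-negative in a Banach space `X`, `-A_D` generating a bounded `C₀`-semigroup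
`(T(t))` on `D := closure D(A)`.  The closure of the
Dirichlet-to-Neumann operator `T_α` equals `c_α` times the closure of the Balakrishnan
operator `J^α_A`, with `c_α = Γ(1-α)/(2^{2α-1}Γ(α))`; stated as equality of the closures
of the graphs of `c_α J^α_A` and of `T_α`. -/
theorem stmt14 {X : Type*} [NormedAddCommGroup X] [NormedSpace ℂ X] [CompleteSpace X]
    (A : X →ₗ.[ℂ] X) (R : ℝ → X →L[ℂ] X) (M : ℝ)
    (α : ℂ) (h0 : 0 < α.re) (h1 : α.re < 1)
    (hR : ∀ l : ℝ, 0 < l → ∀ y : X,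
      ∃ h : R l y ∈ A.domain, A ⟨R l y, h⟩ + (l : ℂ) • R l y = y)
    (hRinv : ∀ l : ℝ, 0 < l → ∀ x : A.domain, R l (A x + (l : ℂ) • (x : X)) = x)
    (hM : ∀ l : ℝ, 0 < l → ‖(l : ℂ) • R l‖ ≤ M)
    (T : ℝ → X →L[ℂ] X)
    (hTD : ∀ t : ℝ, 0 ≤ t → ∀ y ∈ closure (A.domain : Set X),
      T t y ∈ closure (A.domain : Set X))
    (hT0 : ∀ y ∈ closure (A.domain : Set X), T 0 y = y)
    (hsemi : ∀ s t : ℝ, 0 ≤ s → 0 ≤ t → ∀ y ∈ closure (A.domain : Set X),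
      T (s + t) y = T s (T t y))
    (hcont : ∀ y ∈ closure (A.domain : Set X), ContinuousOn (fun t => T t y) (Ici 0))
    (hbdd : ∀ t : ℝ, 0 ≤ t → ∀ y ∈ closure (A.domain : Set X), ‖T t y‖ ≤ M * ‖y‖)
    (hgen : ∀ x : A.domain, ∀ t : ℝ, 0 ≤ t →
      ∃ hm : T t (x : X) ∈ A.domain,
        HasDerivAt (fun s => T s (x : X)) (-(A ⟨T t (x : X), hm⟩)) t)
    :
    closure {p : X × X | ∃ hx : p.1 ∈ A.domain,
        p.2 = (Complex.Gamma (1 - α) / (2 ^ (2 * α - 1) * Complex.Gamma α)) •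
          ((Complex.sin (α * Real.pi) / (Real.pi : ℂ)) •
            ∫ t in Ioi (0:ℝ), ((t : ℂ) ^ (α - 1)) • R t (A ⟨p.1, hx⟩))} =
      closure {p : X × X | p.1 ∈ closure (A.domain : Set X) ∧
        Tendsto (fun t : ℝ => -(((t : ℂ) ^ ((1 : ℂ) - 2 * α)) •
            deriv (fun s : ℝ => (1 / Complex.Gamma α) •
              ((((s : ℂ) / 2) ^ (2 * α)) •
                ∫ r in Ioi (0:ℝ),
                  (((r : ℂ) ^ (-α - 1)) * (Real.exp (-(s ^ 2) / (4 * r)) : ℂ)) • T r p.1)) t))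
          (𝓝[>] (0:ℝ)) (𝓝 p.2)} := by
  have hdense : ∀ y : X, y ∈ closure (A.domain : Set X) := by
    have hmem : ∀ x : A.domain, A x ∈ A.domain.topologicalClosure := fun x => by
      obtain ⟨hm, hd⟩ := hgen x 0 le_rfl
      have hx : (⟨T 0 (x : X), hm⟩ : A.domain) = x :=
        Subtype.ext (hT0 x (subset_closure x.2))
      rw [hx] at hd
      rw [← neg_neg (A x)]
      refine Submodule.neg_mem _ (A.domain.isClosed_topologicalClosure.mem_of_tendsto
        hd.tendsto_slope_zero_right ?_)
      filter_upwards [self_mem_nhdsWithin] with t (ht : 0 < t)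
      refine Submodule.smul_of_tower_mem _ _ (Submodule.sub_mem _ ?_ ?_)
      · exact hTD _ (by simpa using ht.le) _ (subset_closure x.2)
      · exact hTD _ le_rfl _ (subset_closure x.2)
    intro y
    obtain ⟨h, hy⟩ := hR 1 one_pos y
    rw [← hy]
    exact A.domain.topologicalClosure.add_mem (hmem _)
      (Submodule.smul_mem _ _ (A.domain.le_topologicalClosure h))
  have hTbdd : ∀ x : X, ∀ r : ℝ, 0 < r → ‖T r x‖ ≤ M * ‖x‖ := fun x r hr =>
    hbdd r hr.le x (hdense x)
  have hTmeas : ∀ x : X, AEStronglyMeasurable (fun r => T r x) (volume.restrict (Ioi 0)) :=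
    fun x => ((hcont x (hdense x)).mono Ioi_subset_Ici_self).aestronglyMeasurable
      measurableSet_Ioi
  have hlaplace : ∀ l : ℝ, 0 < l → ∀ x ∈ A.domain,
      R l x = ∫ r in Ioi (0 : ℝ), (Real.exp (-(l * r)) : ℂ) • T r x := fun l hl x hx => by
    have := resolvent_apply_eq_integral hl (hRinv l hl) (u := fun t => T t x)
      (hgen ⟨x, hx⟩) (fun t ht => hbdd t ht x (hdense x))
    simpa only [hT0 x (hdense x)] using this
  have hcomm : ∀ l : ℝ, 0 < l → ∀ s : ℝ, 0 < s → ∀ x : X, R l (T s x) = T s (R l x) := by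
    intro l hl s hs
    have heq : EqOn (fun x => R l (T s x)) (fun x => T s (R l x)) (A.domain : Set X) := by
      intro x hx
      obtain ⟨hm, -⟩ := hgen ⟨x, hx⟩ s hs.le
      simp only
      rw [hlaplace l hl _ hm, hlaplace l hl x hx, ← ContinuousLinearMap.integral_comp_comm _
        (integrableOn_exp_neg_mul_smul hl (hTmeas x) (hTbdd x))]
      refine setIntegral_congr_fun measurableSet_Ioi fun r (hr : 0 < r) => ?_
      simp only [map_smul]
      rw [← hsemi r s hr.le hs.le x (hdense x), ← hsemi s r hs.le hr.le x (hdense x), add_comm]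
    exact congrFun (Continuous.ext_on (fun y => hdense y) (by fun_prop) (by fun_prop) heq)
  have hU : ∀ x : X, ∀ t : ℝ, 0 < t → -(((t : ℂ) ^ ((1 : ℂ) - 2 * α)) •
      deriv (fun s : ℝ => (1 / Complex.Gamma α) •
        ((((s : ℂ) / 2) ^ (2 * α)) •
          ∫ r in Ioi (0:ℝ),
            (((r : ℂ) ^ (-α - 1)) * (Real.exp (-(s ^ 2) / (4 * r)) : ℂ)) • T r x)) t) =
      (2 ^ (1 - 2 * α) / Complex.Gamma α) •
        ∫ r in Ioi (0 : ℝ), (-α * expWeight (-α - 1) t r +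
          (t : ℂ) ^ 2 / 4 * expWeight (-α - 2) t r) • T r x := fun x t ht => by
    have ht' : (t : ℂ) ≠ 0 := by exact_mod_cast ht.ne'
    have hd := (hasDerivAt_extension h0 ht (hTmeas x) (hTbdd x)).deriv
    simp only [expWeight] at hd ⊢
    rw [hd, smul_smul, mul_neg, ← Complex.cpow_add _ _ ht', neg_smul, neg_neg,
      show (1 - 2 * α + (2 * α - 1)) = 0 by ring, Complex.cpow_zero, one_smul]
  have hgraph : ∀ x (hx : x ∈ A.domain), Tendsto (fun t : ℝ => -(((t : ℂ) ^ ((1 : ℂ) - 2 * α)) •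
      deriv (fun s : ℝ => (1 / Complex.Gamma α) •
        ((((s : ℂ) / 2) ^ (2 * α)) •
          ∫ r in Ioi (0:ℝ),
            (((r : ℂ) ^ (-α - 1)) * (Real.exp (-(s ^ 2) / (4 * r)) : ℂ)) • T r x)) t))
      (𝓝[>] (0:ℝ)) (𝓝 ((Complex.Gamma (1 - α) / (2 ^ (2 * α - 1) * Complex.Gamma α)) •
          ((Complex.sin (α * Real.pi) / (Real.pi : ℂ)) •
            ∫ t in Ioi (0:ℝ), ((t : ℂ) ^ (α - 1)) • R t (A ⟨x, hx⟩)))) := by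
    intro x hx
    have hx0 : T 0 x = x := hT0 x (hdense x)
    have hK : ∀ r : ℝ, 0 < r → ‖T r x - x‖ ≤ M * ‖x‖ + ‖x‖ := fun r hr =>
      (norm_sub_le _ _).trans (by gcongr; exact hTbdd x r hr)
    obtain ⟨C, hC⟩ := exists_norm_sub_le_mul_of_hasDerivAt (f := fun s => T s x)
      (hgen ⟨x, hx⟩ 0 le_rfl).choose_spec (by simpa only [hx0] using hK)
    simp only [hx0] at hC
    have hlim := (tendsto_integral_deriv_expWeight_smul h0 h1 (hTmeas x) hC
      (hTbdd x)).const_smul (2 ^ (1 - 2 * α) / Complex.Gamma α)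
    have hJ : ∀ t ∈ Ioi (0 : ℝ), ((t : ℂ) ^ (α - 1)) • R t (A ⟨x, hx⟩) =
        (t : ℂ) ^ α • ∫ r in Ioi (0 : ℝ), (Real.exp (-(t * r)) : ℂ) • (x - T r x) := by
      intro t (ht : 0 < t)
      have ht' : (t : ℂ) ≠ 0 := by exact_mod_cast ht.ne'
      have hRA := hRinv t ht ⟨x, hx⟩
      rw [map_add, map_smul] at hRA
      simp only [smul_sub]
      rw [integral_sub (integrableOn_exp_neg_mul_smul ht (g := fun _ => x)
          aestronglyMeasurable_const (fun _ _ => le_rfl))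
        (integrableOn_exp_neg_mul_smul ht (hTmeas x) (hTbdd x)), ← hlaplace t ht x hx,
        integral_smul_const, integral_exp_neg_mul_Ioi ht, eq_sub_of_add_eq hRA,
        Complex.cpow_sub _ _ ht', Complex.cpow_one, smul_sub, smul_sub, smul_smul, smul_smul,
        div_mul_cancel₀ _ ht', div_eq_mul_inv]
    have hhmeas : AEStronglyMeasurable (fun r => x - T r x) (volume.restrict (Ioi 0)) :=
      aestronglyMeasurable_const.sub (hTmeas x)
    have hneg : ∫ r in Ioi (0 : ℝ), (-α * (r : ℂ) ^ (-α - 1)) • (T r x - x) =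
        α • ∫ r in Ioi (0 : ℝ), (r : ℂ) ^ (-α - 1) • (x - T r x) := by
      rw [← integral_smul]
      congr 1 with r
      module
    rw [setIntegral_congr_fun measurableSet_Ioi hJ, integral_cpow_smul_laplace h0 h1 hhmeas
      (fun r hr => by rw [norm_sub_rev]; exact hC r hr)
      (fun r hr => by rw [norm_sub_rev]; exact hK r hr), smul_smul, smul_smul, mul_assoc,
      balakrishnan_constant h0 h1, mul_smul, ← hneg]
    refine hlim.congr' ?_
    filter_upwards [self_mem_nhdsWithin] with t ht
    exact (hU x t ht).symm
  refine (closure_mono ?_).antisymm (closure_minimal ?_ isClosed_closure)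
  · rintro p ⟨hx, hp⟩
    exact ⟨hdense p.1, by rw [hp]; exact hgraph p.1 hx⟩
  · rintro ⟨x, y⟩ ⟨-, hlim⟩
    refine mem_closure_of_tendsto ((tendsto_smul_resolvent hRinv hM (hdense x)).prodMk_nhds
      (tendsto_smul_resolvent hRinv hM (hdense y))) ?_
    filter_upwards [eventually_gt_atTop 0] with l hl
    have hxl : ((l : ℂ) • R l) x ∈ A.domain :=
      A.domain.smul_mem _ (hR l hl x).choose
    refine ⟨hxl, tendsto_nhds_unique ?_ (hgraph _ hxl)⟩
    refine ((((l : ℂ) • R l).continuous.tendsto y).comp hlim).congr' ?_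
    filter_upwards [self_mem_nhdsWithin] with t (ht : 0 < t)
    rw [Function.comp_apply, hU _ t ht, hU _ t ht, map_smul,
      ← ContinuousLinearMap.integral_comp_comm _
        (integrableOn_deriv_expWeight_smul h0 ht.ne' (hTmeas x) (hTbdd x))]
    congr 1
    refine setIntegral_congr_fun measurableSet_Ioi fun r (hr : 0 < r) => ?_
    simp only [map_smul, smul_apply, hcomm l hl r hr]
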